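/- arXiv:0711.5020 — 2 statements merged into one kernel-verified Lean document; each statement's English description precedes it below -/
import Mathlib

section
/- Let p be an odd prime, n ≥ 5, and for ε ∈ F_p let G(ε) be the group of order pⁿ presented by generators A, B, C, D with relations: A^p = B^p = C^p = 1, C central, B = [A,D], C = [A,B], [B,D] = 1, and D^{p^{n−3}} = C^ε. If G(ε) ≅ G(ε′) with ε, ε′ ∈ F_p^×, then ε/ε′ is a square in F_p^×. Consequently there are exactly three isomorphism classes among the G(ε): ε = 0, ε a quadratic residue, and ε a quadratic non-residue. -/
/-- The relators for the group `G(ε)` of order `pⁿ`, on generators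
`A = 0, B = 1, C = 2, D = 3`: `A^p = B^p = C^p = 1`, `C` is central,
`B = [A,D]`, `C = [A,B]`, `[B,D] = 1`, and `D^{p^{n-3}} = C^ε`
(commutators in the convention `[g,h] = g⁻¹h⁻¹gh`). -/
def ggRels (p n : ℕ) (ε : ZMod p) : Set (FreeGroup (Fin 4)) :=
  { FreeGroup.of 0 ^ p, FreeGroup.of 1 ^ p, FreeGroup.of 2 ^ p,
    (FreeGroup.of 2)⁻¹ * (FreeGroup.of 0)⁻¹ * FreeGroup.of 2 * FreeGroup.of 0,
    (FreeGroup.of 2)⁻¹ * (FreeGroup.of 1)⁻¹ * FreeGroup.of 2 * FreeGroup.of 1,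
    (FreeGroup.of 2)⁻¹ * (FreeGroup.of 3)⁻¹ * FreeGroup.of 2 * FreeGroup.of 3,
    (FreeGroup.of 1)⁻¹ *
      ((FreeGroup.of 0)⁻¹ * (FreeGroup.of 3)⁻¹ * FreeGroup.of 0 * FreeGroup.of 3),
    (FreeGroup.of 2)⁻¹ *
      ((FreeGroup.of 0)⁻¹ * (FreeGroup.of 1)⁻¹ * FreeGroup.of 0 * FreeGroup.of 1),
    (FreeGroup.of 1)⁻¹ * (FreeGroup.of 3)⁻¹ * FreeGroup.of 1 * FreeGroup.of 3,
    FreeGroup.of 3 ^ (p ^ (n - 3)) * (FreeGroup.of 2 ^ (ε.val))⁻¹ }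

/-- Four elements of a group that satisfy the relations of `G(ε)`. -/
structure GGRelations {G : Type*} [Group G] (p n : ℕ) (ε : ZMod p) (A B C D : G) : Prop where
  A_pow : A ^ p = 1
  B_pow : B ^ p = 1
  C_pow : C ^ p = 1
  comm_CA : Commute C A
  comm_CB : Commute C B
  comm_CD : Commute C D
  B_eq : B = A⁻¹ * D⁻¹ * A * D
  C_eq : C = A⁻¹ * B⁻¹ * A * B
  comm_BD : Commute B D
  D_pow : D ^ (p ^ (n - 3)) = C ^ ε.val

theorem commute_iff_inv_mul_inv_mul_mul {G : Type*} [Group G] (a b : G) :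
    a⁻¹ * b⁻¹ * a * b = 1 ↔ Commute a b := by
  rw [Commute, SemiconjBy, ← mul_inv_rev, mul_assoc, inv_mul_eq_one, eq_comm]

namespace GGRelations

variable {G : Type*} [Group G] {p n : ℕ} {ε : ZMod p} {A B C D : G}

theorem lift_rels (h : GGRelations p n ε A B C D) :
    ∀ r ∈ ggRels p n ε, FreeGroup.lift ![A, B, C, D] r = 1 := by
  intro r hr
  simp only [ggRels, Set.mem_insert_iff, Set.mem_singleton_iff] at hr
  rcases hr with rfl | rfl | rfl | rfl | rfl | rfl | rfl | rfl | rfl | rfl <;>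
    simp only [map_mul, map_inv, map_pow, FreeGroup.lift_apply_of, Matrix.cons_val]
  · exact h.A_pow
  · exact h.B_pow
  · exact h.C_pow
  · exact (commute_iff_inv_mul_inv_mul_mul _ _).2 h.comm_CA
  · exact (commute_iff_inv_mul_inv_mul_mul _ _).2 h.comm_CB
  · exact (commute_iff_inv_mul_inv_mul_mul _ _).2 h.comm_CD
  · rw [inv_mul_eq_one]; exact h.B_eq
  · rw [inv_mul_eq_one]; exact h.C_eq
  · exact (commute_iff_inv_mul_inv_mul_mul _ _).2 h.comm_BD
  · rw [mul_inv_eq_one]; exact h.D_pow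

/-- The homomorphism from `G(ε)` determined by elements that satisfy its relations. -/
def hom (h : GGRelations p n ε A B C D) : PresentedGroup (ggRels p n ε) →* G :=
  PresentedGroup.toGroup h.lift_rels

theorem hom_of (h : GGRelations p n ε A B C D) (i : Fin 4) :
    h.hom (PresentedGroup.of i) = ![A, B, C, D] i :=
  PresentedGroup.toGroup.of h.lift_rels

theorem conj_B_pow (h : GGRelations p n ε A B C D) (k : ℕ) :
    (A ^ k)⁻¹ * B * A ^ k = B * (C ^ k)⁻¹ := by
  have hAB : A⁻¹ * B * A = B * C⁻¹ := by
    rw [h.C_eq]; group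
  induction k with
  | zero => simp
  | succ k ih =>
    calc (A ^ (k + 1))⁻¹ * B * A ^ (k + 1)
        = A⁻¹ * ((A ^ k)⁻¹ * B * A ^ k) * A := by rw [pow_succ]; group
      _ = A⁻¹ * B * ((C ^ k)⁻¹ * A) := by rw [ih]; group
      _ = A⁻¹ * B * (A * (C ^ k)⁻¹) := by rw [((h.comm_CA.pow_left k).inv_left).eq]
      _ = (A⁻¹ * B * A) * (C ^ k)⁻¹ := by group
      _ = B * (C ^ (k + 1))⁻¹ := by rw [hAB, pow_succ]; group

theorem commutator_pow_left (h : GGRelations p n ε A B C D) (k : ℕ) :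
    ∃ s : ℤ, (A ^ k)⁻¹ * D⁻¹ * A ^ k * D = B ^ k * C ^ s := by
  induction k with
  | zero => exact ⟨0, by simp⟩
  | succ k ih =>
    obtain ⟨s, hs⟩ := ih
    refine ⟨-k + s, ?_⟩
    calc (A ^ (k + 1))⁻¹ * D⁻¹ * A ^ (k + 1) * D
        = (A ^ k)⁻¹ * (A⁻¹ * D⁻¹ * A * D) * A ^ k * ((A ^ k)⁻¹ * D⁻¹ * A ^ k * D) := by
          rw [pow_succ']; group
      _ = B * ((C ^ k)⁻¹ * B ^ k) * C ^ s := by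
          rw [← h.B_eq, h.conj_B_pow, hs]; group
      _ = B * (B ^ k * (C ^ k)⁻¹) * C ^ s := by
          rw [(((h.comm_CB.pow_left k).inv_left).pow_right k).eq]
      _ = B ^ (k + 1) * C ^ (-k + s) := by rw [pow_succ', zpow_add]; group

theorem pow_A (h : GGRelations p n ε A B C D) [Fact p.Prime] {ε' : ZMod p} (a : ℕ)
    (ha : ε = ε' * (a : ZMod p) ^ 2) :
    GGRelations p n ε' (A ^ a) ((A ^ a)⁻¹ * D⁻¹ * A ^ a * D) (C ^ (a ^ 2)) D := by
  obtain ⟨s, hs⟩ := h.commutator_pow_left a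
  have hCB : Commute C (B ^ a * C ^ s) :=
    (h.comm_CB.pow_right a).mul_right ((Commute.refl C).zpow_right s)
  constructor
  · rw [← pow_mul, mul_comm, pow_mul, h.A_pow, one_pow]
  · rw [hs, ((h.comm_CB.symm.pow_left a).zpow_right s).mul_pow, ← pow_mul, mul_comm, pow_mul,
      h.B_pow, one_pow, one_mul, ← zpow_natCast, ← zpow_mul, mul_comm, zpow_mul, zpow_natCast,
      h.C_pow, one_zpow]
  · rw [← pow_mul, mul_comm, pow_mul, h.C_pow, one_pow]
  · exact h.comm_CA.pow_pow _ _
  · rw [hs]; exact hCB.pow_left _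
  · exact h.comm_CD.pow_left _
  · rfl
  · have hc : (A ^ a)⁻¹ * B ^ a * A ^ a = B ^ a * (C ^ a ^ 2)⁻¹ := by
      calc (A ^ a)⁻¹ * B ^ a * A ^ a = ((A ^ a)⁻¹ * B * A ^ a) ^ a := by
            have := conj_pow (a := (A ^ a)⁻¹) (b := B) (i := a)
            rwa [inv_inv, eq_comm] at this
        _ = B ^ a * (C ^ a ^ 2)⁻¹ := by
            rw [h.conj_B_pow, ((h.comm_CB.symm.pow_right a).inv_right).mul_pow, inv_pow,
              ← pow_mul, sq]
    have hCA : C ^ s * A ^ a = A ^ a * C ^ s := ((h.comm_CA.zpow_left s).pow_right a).eq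
    have hconj : (A ^ a)⁻¹ * (B ^ a * C ^ s) * A ^ a = B ^ a * (C ^ a ^ 2)⁻¹ * C ^ s := by
      rw [mul_assoc, mul_assoc, hCA, ← hc]; group
    rw [hs]
    have hinv : (A ^ a)⁻¹ * (B ^ a * C ^ s)⁻¹ * A ^ a = (B ^ a * (C ^ a ^ 2)⁻¹ * C ^ s)⁻¹ := by
      rw [← hconj]; group
    rw [hinv]
    group
  · rw [hs]
    exact (h.comm_BD.pow_left a).mul_left (h.comm_CD.zpow_left s)
  · rw [h.D_pow, ← pow_mul, pow_eq_pow_iff_modEq]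
    refine Nat.ModEq.of_dvd (orderOf_dvd_of_pow_eq_one h.C_pow) ?_
    rw [← ZMod.natCast_eq_natCast_iff]
    push_cast
    rw [ZMod.natCast_zmod_val, ZMod.natCast_zmod_val, ha, mul_comm]

end GGRelations

theorem PresentedGroup.ggRelations (p n : ℕ) (ε : ZMod p) :
    GGRelations p n ε (PresentedGroup.of (rels := ggRels p n ε) 0) (PresentedGroup.of 1)
      (PresentedGroup.of 2) (PresentedGroup.of 3) := by
  have key : ∀ r ∈ ggRels p n ε, PresentedGroup.mk (ggRels p n ε) r = 1 :=
    fun r hr => PresentedGroup.one_of_mem hr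
  simp only [ggRels, Set.mem_insert_iff, Set.mem_singleton_iff, forall_eq_or_imp, forall_eq] at key
  obtain ⟨h1, h2, h3, h4, h5, h6, h7, h8, h9, h10⟩ := key
  exact ⟨h1, h2, h3, (commute_iff_inv_mul_inv_mul_mul _ _).1 h4,
    (commute_iff_inv_mul_inv_mul_mul _ _).1 h5, (commute_iff_inv_mul_inv_mul_mul _ _).1 h6,
    inv_mul_eq_one.1 h7, inv_mul_eq_one.1 h8, (commute_iff_inv_mul_inv_mul_mul _ _).1 h9,
    mul_inv_eq_one.1 h10⟩

/-- `G(ε)` is generated by `A` and `D`. -/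
theorem PresentedGroup.ggRels_hom_ext {p n : ℕ} {ε : ZMod p} {H : Type*} [Group H]
    {f g : PresentedGroup (ggRels p n ε) →* H}
    (hA : f (PresentedGroup.of 0) = g (PresentedGroup.of 0))
    (hD : f (PresentedGroup.of 3) = g (PresentedGroup.of 3)) : f = g := by
  have h := PresentedGroup.ggRelations p n ε
  have hB : f (PresentedGroup.of 1) = g (PresentedGroup.of 1) := by
    rw [h.B_eq]; simp only [map_mul, map_inv, hA, hD]
  have hC : f (PresentedGroup.of 2) = g (PresentedGroup.of 2) := by
    rw [h.C_eq]; simp only [map_mul, map_inv, hA, hB]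
  refine PresentedGroup.ext fun i => ?_
  fin_cases i
  exacts [hA, hB, hC, hD]

theorem nonempty_mulEquiv_of_eq_mul_sq {p n : ℕ} [Fact p.Prime] {ε ε' r : ZMod p} (hr : r ≠ 0)
    (h : ε = ε' * r ^ 2) :
    Nonempty (PresentedGroup (ggRels p n ε) ≃* PresentedGroup (ggRels p n ε')) := by
  have h' : ε' = ε * ((r⁻¹).val : ZMod p) ^ 2 := by
    rw [ZMod.natCast_zmod_val, h]; field_simp
  rw [← ZMod.natCast_zmod_val r] at h
  have hmod : r.val * (r⁻¹).val ≡ 1 [MOD p] := by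
    rw [← ZMod.natCast_eq_natCast_iff]
    push_cast
    rw [ZMod.natCast_zmod_val, ZMod.natCast_zmod_val, mul_inv_cancel₀ hr]
  have R := PresentedGroup.ggRelations p n ε
  have R' := PresentedGroup.ggRelations p n ε'
  have pow_eq : ∀ {H : Type} [Group H] {x : H}, x ^ p = 1 → x ^ (r.val * (r⁻¹).val) = x := by
    intro H _ x hx
    conv_rhs => rw [← pow_one x]
    rw [pow_eq_pow_iff_modEq]
    exact hmod.of_dvd (orderOf_dvd_of_pow_eq_one hx)
  let f := (R'.pow_A _ h').hom
  let g := (R.pow_A _ h).hom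
  refine ⟨MonoidHom.toMulEquiv f g ?_ ?_⟩
  · apply PresentedGroup.ggRels_hom_ext
    · simp [f, g, GGRelations.hom_of, ← pow_mul, pow_eq R.A_pow]
    · simp [f, g, GGRelations.hom_of]
  · apply PresentedGroup.ggRels_hom_ext
    · simp [f, g, GGRelations.hom_of, ← pow_mul, mul_comm, pow_eq R'.A_pow]
    · simp [f, g, GGRelations.hom_of]

/-- The semidirect product of the abelian group `⟨B, C, D⟩`, with `D` of infinite order,
by `⟨A⟩`: the quadruple `(x, y, z, w)` stands for `A ^ x` times the element `(y, z, w)` of the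
abelian group, in coordinates where `A = (1, 0, 0, 0)`, `B = (0, 1, -1, 0)`, `C = (0, 0, 2, 0)` and
`D = (0, 0, 0, 1)`. -/
@[ext]
structure GGCover (p : ℕ) where
  x : ZMod p
  y : ZMod p
  z : ZMod p
  w : ℤ

namespace GGCover

variable {p : ℕ}

instance : Mul (GGCover p) :=
  ⟨fun g h => ⟨g.x + h.x, g.y - h.x * g.w + h.y, g.z - 2 * h.x * g.y + h.x ^ 2 * g.w + h.z,
    g.w + h.w⟩⟩

instance : One (GGCover p) := ⟨⟨0, 0, 0, 0⟩⟩

instance : Inv (GGCover p) :=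
  ⟨fun g => ⟨-g.x, -(g.y + g.x * g.w), -(g.z + 2 * g.x * g.y + g.x ^ 2 * g.w), -g.w⟩⟩

@[simp] theorem mul_x (g h : GGCover p) : (g * h).x = g.x + h.x := rfl
@[simp] theorem mul_y (g h : GGCover p) : (g * h).y = g.y - h.x * g.w + h.y := rfl
@[simp] theorem mul_z (g h : GGCover p) :
    (g * h).z = g.z - 2 * h.x * g.y + h.x ^ 2 * g.w + h.z := rfl
@[simp] theorem mul_w (g h : GGCover p) : (g * h).w = g.w + h.w := rfl
@[simp] theorem one_x : (1 : GGCover p).x = 0 := rfl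
@[simp] theorem one_y : (1 : GGCover p).y = 0 := rfl
@[simp] theorem one_z : (1 : GGCover p).z = 0 := rfl
@[simp] theorem one_w : (1 : GGCover p).w = 0 := rfl
@[simp] theorem inv_x (g : GGCover p) : g⁻¹.x = -g.x := rfl
@[simp] theorem inv_y (g : GGCover p) : g⁻¹.y = -(g.y + g.x * g.w) := rfl
@[simp] theorem inv_z (g : GGCover p) :
    g⁻¹.z = -(g.z + 2 * g.x * g.y + g.x ^ 2 * g.w) := rfl
@[simp] theorem inv_w (g : GGCover p) : g⁻¹.w = -g.w := rfl

instance : Group (GGCover p) :=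
  Group.ofLeftAxioms
    (fun a b c => by ext <;> simp <;> ring)
    (fun a => by ext <;> simp)
    (fun a => by ext <;> simp; ring)

theorem pow_of_x_eq_zero {g : GGCover p} (hg : g.x = 0) (k : ℕ) :
    g ^ k = ⟨0, k * g.y, k * g.z, k * g.w⟩ := by
  induction k with
  | zero => ext <;> simp
  | succ k ih => rw [pow_succ, ih]; ext <;> simp [hg] <;> ring

theorem mk_pow (x : ZMod p) (k : ℕ) :
    (⟨x, 0, 0, 0⟩ : GGCover p) ^ k = ⟨k * x, 0, 0, 0⟩ := by
  induction k with
  | zero => ext <;> simp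
  | succ k ih => rw [pow_succ, ih]; ext <;> simp; ring

/-- The central subgroup generated by `D ^ N * C ^ (-ε)`. -/
def kernel (N : ℕ) (ε : ZMod p) : Subgroup (GGCover p) where
  carrier := {g | g.x = 0 ∧ g.y = 0 ∧ ∃ m : ℤ, g.w = N * m ∧ g.z = -2 * ε * m}
  one_mem' := ⟨rfl, rfl, 0, by simp, by simp⟩
  mul_mem' := by
    rintro a b ⟨ha, ha', m, ham, ham'⟩ ⟨hb, hb', k, hbk, hbk'⟩
    refine ⟨by simp [ha, hb], by simp [ha', hb, hb'], m + k, ?_, ?_⟩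
    · simp [ham, hbk]; ring
    · simp [ham', hbk', hb]; ring
  inv_mem' := by
    rintro a ⟨ha, ha', m, ham, ham'⟩
    refine ⟨by simp [ha], by simp [ha, ha'], -m, ?_, ?_⟩
    · simp [ham]
    · simp [ham', ha]

theorem kernel_normal {N : ℕ} (hN : p ∣ N) (ε : ZMod p) : (kernel N ε).Normal where
  conj_mem := by
    rintro a ⟨ha, ha', m, ham, ham'⟩ g
    have hw : (a.w : ZMod p) = 0 := by
      rw [ham]; push_cast; rw [(ZMod.natCast_eq_zero_iff N p).2 hN, zero_mul]
    refine ⟨by simp [ha], ?_, m, by simp [ham], ?_⟩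
    · simp [ha, ha', hw]
    · simp [ha, ha', hw, ham']

/-- An element of the kernel without `D`-part has no `C`-part. -/
theorem z_eq_zero_of_mem_kernel {N : ℕ} (hN : N ≠ 0) {ε : ZMod p} {g : GGCover p}
    (hg : g ∈ kernel N ε) (hw : g.w = 0) : g.z = 0 := by
  obtain ⟨-, -, m, hm, hz⟩ := hg
  have : m = 0 := by
    rw [hw, eq_comm, mul_eq_zero] at hm
    exact hm.resolve_left (by exact_mod_cast hN)
  simpa [this] using hz

theorem ggRelations_quotient {n : ℕ} [Fact p.Prime] (ε : ZMod p)
    [(kernel (p ^ (n - 3)) ε).Normal] :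
    GGRelations p n ε (QuotientGroup.mk' (kernel (p ^ (n - 3)) ε) ⟨1, 0, 0, 0⟩)
      (QuotientGroup.mk' _ ⟨0, 1, -1, 0⟩) (QuotientGroup.mk' _ ⟨0, 0, 2, 0⟩)
      (QuotientGroup.mk' _ ⟨0, 0, 0, 1⟩) := by
  constructor
  · rw [← map_pow, mk_pow, CharP.cast_eq_zero, zero_mul]; rfl
  · rw [← map_pow, pow_of_x_eq_zero rfl]; simp only [CharP.cast_eq_zero, zero_mul, mul_zero]; rfl
  · rw [← map_pow, pow_of_x_eq_zero rfl]; simp only [CharP.cast_eq_zero, zero_mul, mul_zero]; rfl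
  · refine Commute.map (?_ : _ = _) _; ext <;> simp
  · refine Commute.map (?_ : _ = _) _; ext <;> simp [add_comm]
  · refine Commute.map (?_ : _ = _) _; ext <;> simp
  · simp only [← map_mul, ← map_inv]; congr 1; ext <;> simp
  · simp only [← map_mul, ← map_inv]; congr 1; ext <;> simp
  · refine Commute.map (?_ : _ = _) _; ext <;> simp
  · rw [← map_pow, ← map_pow, QuotientGroup.mk'_eq_mk']
    refine ⟨⟨0, 0, 2 * ε, -(p : ℤ) ^ (n - 3)⟩, ⟨rfl, rfl, -1, by simp, by simp⟩, ?_⟩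
    rw [pow_of_x_eq_zero rfl, pow_of_x_eq_zero rfl]
    ext <;> simp [mul_comm]

/-- The homomorphism `A ^ x * (y, z, w) ↦ u * x + v * w` on the quotient by the kernel. -/
def linearHom {N : ℕ} (hN : p ∣ N) (ε : ZMod p) [(kernel N ε).Normal] (u v : ZMod p) :
    GGCover p ⧸ kernel N ε →* Multiplicative (ZMod p) :=
  QuotientGroup.lift _
    { toFun := fun g => Multiplicative.ofAdd (u * g.x + v * g.w)
      map_one' := by simp
      map_mul' := fun a b => by
        rw [← ofAdd_add]; congr 1; simp; ring }
    (by
      rintro a ⟨ha, -, m, ham, -⟩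
      have hw : (a.w : ZMod p) = 0 := by
        rw [ham]; push_cast; rw [(ZMod.natCast_eq_zero_iff N p).2 hN, zero_mul]
      simp [ha, hw])

theorem linearHom_mk {N : ℕ} (hN : p ∣ N) (ε : ZMod p) [(kernel N ε).Normal] (u v : ZMod p)
    (g : GGCover p) :
    linearHom hN ε u v (QuotientGroup.mk' _ g) = Multiplicative.ofAdd (u * g.x + v * g.w) :=
  rfl

end GGCover

theorem eq_mul_sq_of_mulEquiv {p n : ℕ} [Fact p.Prime] (hodd : Odd p) (hn : 5 ≤ n)
    {ε ε' : ZMod p} (φ : PresentedGroup (ggRels p n ε) ≃* PresentedGroup (ggRels p n ε')) :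
    ∃ r : ZMod p, r ≠ 0 ∧ ε' = ε * r ^ 2 := by
  have hp : p.Prime := Fact.out
  set N := p ^ (n - 3)
  have hN : p ∣ N := dvd_pow_self p (by omega)
  have hN0 : N ≠ 0 := pow_ne_zero _ hp.ne_zero
  have htwo : (2 : ZMod p) ≠ 0 := by
    have hlt : 2 < p := by
      have := hp.two_le
      rcases hodd with ⟨k, hk⟩
      omega
    have hcop := (ZMod.natCast_eq_zero_iff 2 p).not.2 (Nat.not_dvd_of_pos_of_lt two_pos hlt)
    exact_mod_cast hcop
  have hNp : (N : ZMod p) = 0 := (ZMod.natCast_eq_zero_iff N p).2 hN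
  have : (GGCover.kernel N ε').Normal := GGCover.kernel_normal hN ε'
  have R := PresentedGroup.ggRelations p n ε
  have R' := GGCover.ggRelations_quotient (n := n) ε'
  let π := R'.hom
  let ψ := π.comp φ.toMonoidHom
  obtain ⟨α, hα⟩ := QuotientGroup.mk'_surjective _ (ψ (PresentedGroup.of 0))
  obtain ⟨δ, hδ⟩ := QuotientGroup.mk'_surjective _ (ψ (PresentedGroup.of 3))
  set q := QuotientGroup.mk' (GGCover.kernel N ε')
  have hdet : α.x * δ.w - α.w * δ.x ≠ 0 := by
    intro hdet
    have key : ∀ u v : ZMod p, u * α.x + v * α.w = 0 → u * δ.x + v * δ.w = 0 →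
        u = 0 ∧ v = 0 := by
      intro u v h1 h2
      have htriv : (GGCover.linearHom hN ε' u v).comp ψ = 1 := by
        apply PresentedGroup.ggRels_hom_ext
        · rw [MonoidHom.comp_apply, ← hα, GGCover.linearHom_mk, h1]; rfl
        · rw [MonoidHom.comp_apply, ← hδ, GGCover.linearHom_mk, h2]; rfl
      have hπ : ∀ y, GGCover.linearHom hN ε' u v (π y) = 1 := by
        intro y
        obtain ⟨x, rfl⟩ := φ.surjective y
        exact DFunLike.congr_fun htriv x
      have hA := hπ (PresentedGroup.of 0)
      have hD := hπ (PresentedGroup.of 3)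
      simp only [π, GGRelations.hom_of, Matrix.cons_val] at hA hD
      erw [GGCover.linearHom_mk] at hA hD
      exact ⟨by simpa using hA, by simpa using hD⟩
    have h1 := key δ.w (-δ.x) (by linear_combination hdet) (by ring)
    have h2 := key α.w (-α.x) (by ring) (by linear_combination -hdet)
    have h3 := key 1 0 (by simpa using h2.2) (by simpa using h1.2)
    exact one_ne_zero h3.1
  obtain ⟨β, hβ⟩ : ∃ β, β = α⁻¹ * δ⁻¹ * α * δ := ⟨_, rfl⟩
  obtain ⟨γ, hγ⟩ : ∃ γ, γ = α⁻¹ * β⁻¹ * α * β := ⟨_, rfl⟩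
  have hβψ : q β = ψ (PresentedGroup.of 1) := by
    rw [R.B_eq, hβ]; simp only [map_mul, map_inv, hα, hδ]
  have hγψ : q γ = ψ (PresentedGroup.of 2) := by
    rw [R.C_eq, hγ]; simp only [map_mul, map_inv, hα, hβψ]
  have hβx : β.x = 0 := by rw [hβ]; simp
  have hβw : β.w = 0 := by rw [hβ]; simp
  have hβy : β.y = α.x * δ.w - α.w * δ.x := by rw [hβ]; simp; ring
  have hγx : γ.x = 0 := by rw [hγ]; simp
  have hγw : γ.w = 0 := by rw [hγ]; simp
  have hγz : γ.z = 2 * α.x * (α.x * δ.w - α.w * δ.x) := by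
    rw [hγ, ← hβy]; simp [hβx, hβw]; ring
  have hδx : δ.x = 0 := by
    have hmem : β⁻¹ * δ⁻¹ * β * δ ∈ GGCover.kernel N ε' := by
      rw [← QuotientGroup.ker_mk' (GGCover.kernel N ε'), MonoidHom.mem_ker]
      change q _ = 1
      simp only [map_mul, map_inv, hβψ, hδ]
      rw [commute_iff_inv_mul_inv_mul_mul]
      exact R.comm_BD.map ψ
    have hz := GGCover.z_eq_zero_of_mem_kernel hN0 hmem (by simp)
    have hz' : 2 * (δ.x * (α.x * δ.w - α.w * δ.x)) = 0 := by
      rw [← hβy, ← neg_eq_zero, ← hz]; simp [hβx, hβw]; ring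
    simpa [htwo, hdet] using hz'
  have hmem : δ ^ N * (γ ^ ε.val)⁻¹ ∈ GGCover.kernel N ε' := by
    rw [← QuotientGroup.ker_mk' (GGCover.kernel N ε'), MonoidHom.mem_ker]
    change q _ = 1
    rw [map_mul, map_inv, map_pow, map_pow, hδ, hγψ, mul_inv_eq_one, ← map_pow, ← map_pow,
      R.D_pow]
  obtain ⟨-, -, m, hmw, hmz⟩ := hmem
  rw [GGCover.pow_of_x_eq_zero hδx, GGCover.pow_of_x_eq_zero hγx] at hmw hmz
  have hm : δ.w = m := by
    simpa [hγw, hN0] using hmw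
  simp [hNp, hγz, hδx, ← hm] at hmz
  rw [hδx, mul_zero, sub_zero] at hdet
  have hd : (δ.w : ZMod p) ≠ 0 := right_ne_zero_of_mul hdet
  refine ⟨α.x, left_ne_zero_of_mul hdet, ?_⟩
  apply mul_left_cancel₀ (mul_ne_zero htwo hd)
  linear_combination -hmz


/-- For an odd prime `p` and `n ≥ 5`: if `G(ε) ≅ G(ε')` with `ε, ε' ∈ F_p^×` then
`ε/ε'` is a square in `F_p^×` (i.e. `ε = ε' r²` for some `r`); consequently
`G(ε) ≅ G(ε')` holds precisely when either `ε = ε' = 0`, or `ε, ε'` are both nonzero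
with `ε/ε'` a square, giving exactly three isomorphism classes (`ε = 0`,
`ε` a quadratic residue, `ε` a quadratic non-residue). -/
theorem stmt_10 (p n : ℕ) (hp : p.Prime) (hodd : Odd p) (hn : 5 ≤ n) :
    (∀ ε ε' : ZMod p, ε ≠ 0 → ε' ≠ 0 →
        Nonempty (PresentedGroup (ggRels p n ε) ≃* PresentedGroup (ggRels p n ε')) →
        ∃ r : ZMod p, ε = ε' * r ^ 2) ∧
    (∀ ε ε' : ZMod p,
        Nonempty (PresentedGroup (ggRels p n ε) ≃* PresentedGroup (ggRels p n ε')) ↔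
          ((ε = 0 ∧ ε' = 0) ∨
            (ε ≠ 0 ∧ ε' ≠ 0 ∧ ∃ r : ZMod p, ε = ε' * r ^ 2))) := by
  have : Fact p.Prime := ⟨hp⟩
  have forward : ∀ ε ε' : ZMod p,
      Nonempty (PresentedGroup (ggRels p n ε) ≃* PresentedGroup (ggRels p n ε')) →
        ∃ r : ZMod p, r ≠ 0 ∧ ε = ε' * r ^ 2 :=
    fun ε ε' ⟨φ⟩ => eq_mul_sq_of_mulEquiv hodd hn φ.symm
  refine ⟨fun ε ε' _ _ h => (forward ε ε' h).imp fun r hr => hr.2, fun ε ε' => ⟨fun h => ?_, ?_⟩⟩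
  · obtain ⟨r, hr, rfl⟩ := forward ε ε' h
    by_cases hε : ε' = 0
    · exact Or.inl ⟨by simp [hε], hε⟩
    · exact Or.inr ⟨by simp [hε, hr], hε, r, rfl⟩
  · rintro (⟨rfl, rfl⟩ | ⟨hε, -, r, h⟩)
    · exact ⟨MulEquiv.refl _⟩
    · refine nonempty_mulEquiv_of_eq_mul_sq (r := r) ?_ h
      rintro rfl
      exact hε (by simpa using h)
end

section
/- Let p be a prime, and suppose a cyclic group Q = C_3 acts non-trivially and linearly on the polynomial ring F_5[x, x'] (with x, x' of degree 1). Then the fixed-point subring F_5[x,x']^{C_3} is generated by three elements a, b, c of degrees 2, 3, 3 respectively, subject to the single relation c² = 3(b² + a³). -/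
open MvPolynomial

/-- The action of a `2×2` matrix over `F_5` on `F_5[x, x']` by linear substitution. -/
noncomputable def linSub5 (M : Matrix (Fin 2) (Fin 2) (ZMod 5)) :
    MvPolynomial (Fin 2) (ZMod 5) →ₐ[ZMod 5] MvPolynomial (Fin 2) (ZMod 5) :=
  aeval (fun i => ∑ j : Fin 2, C (M i j) * X j)

namespace CyclicThree

/-- The polynomial ring `F_5[u, v]`. -/
abbrev Poly := MvPolynomial (Fin 2) (ZMod 5)

/-- The order-three substitution `u ↦ v`, `v ↦ -u - v`. -/
noncomputable def rot : Poly →ₐ[ZMod 5] Poly := aeval ![X 1, -X 0 - X 1]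

/-- The involution `u ↦ -v`, `v ↦ -u`. -/
noncomputable def flip : Poly →ₐ[ZMod 5] Poly := aeval ![-X 1, -X 0]

/-- The quadratic invariant of `rot`. -/
noncomputable def invA : Poly := X 0 ^ 2 + X 0 * X 1 + X 1 ^ 2

/-- The cubic invariant of `rot` fixed by `flip`. -/
noncomputable def invB : Poly :=
  2 * X 1 ^ 3 + 3 * X 1 ^ 2 * X 0 - 3 * X 1 * X 0 ^ 2 - 2 * X 0 ^ 3

/-- The cubic invariant of `rot` negated by `flip`. -/
noncomputable def invC : Poly := 3 * X 0 * X 1 * (X 0 + X 1)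

theorem fact_prime_five : Fact (Nat.Prime 5) := ⟨by norm_num⟩

theorem five_eq_zero : (5 : Poly) = 0 := by
  exact_mod_cast CharP.cast_eq_zero Poly 5

@[simp] theorem rot_X_zero : rot (X 0) = X 1 := by simp [rot]

@[simp] theorem rot_X_one : rot (X 1) = -X 0 - X 1 := by simp [rot]

@[simp] theorem flip_X_zero : flip (X 0) = -X 1 := by simp [flip]

@[simp] theorem flip_X_one : flip (X 1) = -X 0 := by simp [flip]

theorem rot_invA : rot invA = invA := by
  simp only [invA, map_add, map_mul, map_pow, rot_X_zero, rot_X_one]; ring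

theorem rot_invB : rot invB = invB := by
  simp only [invB, map_add, map_sub, map_mul, map_pow, map_ofNat, rot_X_zero, rot_X_one]; ring

theorem rot_invC : rot invC = invC := by
  simp only [invC, map_add, map_mul, map_ofNat, rot_X_zero, rot_X_one]; ring

theorem flip_invA : flip invA = invA := by
  simp only [invA, map_add, map_mul, map_pow, flip_X_zero, flip_X_one]; ring

theorem flip_invB : flip invB = invB := by
  simp only [invB, map_add, map_sub, map_mul, map_pow, map_ofNat, flip_X_zero, flip_X_one]; ring

theorem flip_invC : flip invC = -invC := by
  simp only [invC, map_add, map_mul, map_ofNat, flip_X_zero, flip_X_one]; ring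

theorem isHomogeneous_invA : invA.IsHomogeneous 2 := by
  have h (i : Fin 2) := isHomogeneous_X (ZMod 5) i
  exact (((h 0).pow 2).add ((h 0).mul (h 1))).add ((h 1).pow 2)

theorem isHomogeneous_invB : invB.IsHomogeneous 3 := by
  have h (i : Fin 2) := isHomogeneous_X (ZMod 5) i
  have hC (n : ZMod 5) := isHomogeneous_C (Fin 2) n
  have key := (((((hC 2).mul ((h 1).pow 3)).add
    (((hC 3).mul ((h 1).pow 2)).mul (h 0))).sub
    (((hC 3).mul (h 1)).mul ((h 0).pow 2))).sub ((hC 2).mul ((h 0).pow 3)))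
  simpa only [invB, map_ofNat] using key

theorem isHomogeneous_invC : invC.IsHomogeneous 3 := by
  have h (i : Fin 2) := isHomogeneous_X (ZMod 5) i
  have key := (((isHomogeneous_C (Fin 2) (3 : ZMod 5)).mul (h 0)).mul (h 1)).mul ((h 0).add (h 1))
  simpa only [invC, map_ofNat] using key

theorem invC_sq : invC ^ 2 = 3 * (invB ^ 2 + invA ^ 3) := by
  have h5 := five_eq_zero
  simp only [invA, invB, invC]
  grind

/-- The subalgebra generated by the three invariants. -/
noncomputable def invSubalgebra : Subalgebra (ZMod 5) Poly :=
  Algebra.adjoin (ZMod 5) {invA, invB, invC}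

theorem invA_mem : invA ∈ invSubalgebra := Algebra.subset_adjoin (by simp)

theorem invB_mem : invB ∈ invSubalgebra := Algebra.subset_adjoin (by simp)

theorem invC_mem : invC ∈ invSubalgebra := Algebra.subset_adjoin (by simp)

theorem rot_eq_self_of_mem {P : Poly} (hP : P ∈ invSubalgebra) : rot P = P := by
  have : invSubalgebra ≤ AlgHom.equalizer rot (AlgHom.id (ZMod 5) Poly) := by
    refine Algebra.adjoin_le ?_
    rintro _ (rfl | rfl | rfl)
    exacts [rot_invA, rot_invB, rot_invC]
  exact this hP

/-- As a module over the invariants, the polynomial ring is spanned by `1` together with four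
elements of vanishing trace. -/
theorem exists_decomposition (P : Poly) :
    ∃ q₀ ∈ invSubalgebra, ∃ q₁ ∈ invSubalgebra, ∃ q₂ ∈ invSubalgebra,
      ∃ q₃ ∈ invSubalgebra, ∃ q₄ ∈ invSubalgebra,
        P = q₀ + q₁ * X 0 + q₂ * X 1 + q₃ * (X 0 ^ 2 - X 1 ^ 2)
          + q₄ * (X 1 ^ 2 - (X 0 + X 1) ^ 2) := by
  have h5 := five_eq_zero
  induction P using MvPolynomial.induction_on with
  | C r =>
    refine ⟨C r, invSubalgebra.algebraMap_mem r, 0, zero_mem _, 0, zero_mem _, 0, zero_mem _, 0,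
      zero_mem _, by ring⟩
  | add P Q hP hQ =>
    obtain ⟨p₀, hp₀, p₁, hp₁, p₂, hp₂, p₃, hp₃, p₄, hp₄, rfl⟩ := hP
    obtain ⟨q₀, hq₀, q₁, hq₁, q₂, hq₂, q₃, hq₃, q₄, hq₄, rfl⟩ := hQ
    exact ⟨_, add_mem hp₀ hq₀, _, add_mem hp₁ hq₁, _, add_mem hp₂ hq₂, _, add_mem hp₃ hq₃,
      _, add_mem hp₄ hq₄, by ring⟩
  | mul_X P i hP =>
    obtain ⟨q₀, h₀, q₁, h₁, q₂, h₂, q₃, h₃, q₄, h₄, rfl⟩ := hP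
    lift q₀ to invSubalgebra using h₀
    lift q₁ to invSubalgebra using h₁
    lift q₂ to invSubalgebra using h₂
    lift q₃ to invSubalgebra using h₃
    lift q₄ to invSubalgebra using h₄
    let a : invSubalgebra := ⟨invA, invA_mem⟩
    let b : invSubalgebra := ⟨invB, invB_mem⟩
    let c : invSubalgebra := ⟨invC, invC_mem⟩
    have ha : (a : Poly) = X 0 ^ 2 + X 0 * X 1 + X 1 ^ 2 := rfl
    have hb : (b : Poly) =
      2 * X 1 ^ 3 + 3 * X 1 ^ 2 * X 0 - 3 * X 1 * X 0 ^ 2 - 2 * X 0 ^ 3 := rfl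
    have hc : (c : Poly) = 3 * X 0 * X 1 * (X 0 + X 1) := rfl
    have h2 : ((2 : invSubalgebra) : Poly) = 2 := rfl
    have h3 : ((3 : invSubalgebra) : Poly) = 3 := rfl
    have h4 : ((4 : invSubalgebra) : Poly) = 4 := rfl
    fin_cases i
    · refine ⟨_, (4 * a * q₁ + 3 * a * q₂ + (2 * c + 4 * b) * q₃ + 2 * b * q₄).2,
        _, (q₀ + 4 * a * q₃ + 3 * a * q₄).2, _, (2 * a * q₃ + a * q₄).2,
        _, (4 * q₁ + 3 * q₂).2, _, (2 * q₁ + q₂).2, ?_⟩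
      push_cast
      simp only [ha, hb, hc, h2, h3, h4]
      generalize (X 0 : Poly) = u, (X 1 : Poly) = v at *
      grind
    · refine ⟨_, (3 * a * q₁ + 4 * a * q₂ + (3 * c + 4 * b) * q₃ + (2 * c + 4 * b) * q₄).2,
        _, (3 * a * q₃ + 3 * a * q₄).2, _, (q₀ + a * q₃ + 2 * a * q₄).2,
        _, (3 * q₁ + 3 * q₂).2, _, (q₁ + 2 * q₂).2, ?_⟩
      push_cast
      simp only [ha, hb, hc, h2, h3, h4]
      generalize (X 0 : Poly) = u, (X 1 : Poly) = v at *
      grind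

theorem rot_eq_self_iff (P : Poly) : rot P = P ↔ P ∈ invSubalgebra := by
  refine ⟨fun h => ?_, rot_eq_self_of_mem⟩
  obtain ⟨q₀, h₀, q₁, h₁, q₂, h₂, q₃, h₃, q₄, h₄, hP⟩ := exists_decomposition P
  have hrot : P = q₀ + q₁ * X 1 + q₂ * (-X 0 - X 1) + q₃ * (X 1 ^ 2 - (-X 0 - X 1) ^ 2)
      + q₄ * ((-X 0 - X 1) ^ 2 - (X 1 + (-X 0 - X 1)) ^ 2) := by
    have := congrArg rot hP
    simpa only [h, map_add, map_sub, map_mul, map_pow, rot_X_zero, rot_X_one,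
      rot_eq_self_of_mem h₀, rot_eq_self_of_mem h₁, rot_eq_self_of_mem h₂,
      rot_eq_self_of_mem h₃, rot_eq_self_of_mem h₄] using this
  have hrot2 := congrArg rot hrot
  simp only [h, map_add, map_sub, map_neg, map_mul, map_pow, rot_X_zero, rot_X_one,
    rot_eq_self_of_mem h₀, rot_eq_self_of_mem h₁, rot_eq_self_of_mem h₂,
    rot_eq_self_of_mem h₃, rot_eq_self_of_mem h₄] at hrot2
  have : P = q₀ := by
    linear_combination 2 * hP + 2 * hrot + 2 * hrot2 + (q₀ - P) * five_eq_zero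
  rwa [this]

theorem algebraicIndependent_invA_invB : AlgebraicIndependent (ZMod 5) ![invA, invB] := by
  have := fact_prime_five
  let S := Algebra.adjoin (ZMod 5) (Set.range ![invA, invB])
  let a : S := ⟨invA, Algebra.subset_adjoin ⟨0, rfl⟩⟩
  let b : S := ⟨invB, Algebra.subset_adjoin ⟨1, rfl⟩⟩
  have hX (i : Fin 2) : IsIntegral S (X i : Poly) := by
    let p : Polynomial S := .X ^ 6 - .C (2 * a) * .X ^ 4 + .C (a ^ 2) * .X ^ 2
      - .C (2 * (b ^ 2 + a ^ 3))
    refine ⟨p, by simp only [p]; monicity!, ?_⟩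
    have ha : algebraMap S Poly a = X 0 ^ 2 + X 0 * X 1 + X 1 ^ 2 := rfl
    have hb : algebraMap S Poly b =
      2 * X 1 ^ 3 + 3 * X 1 ^ 2 * X 0 - 3 * X 1 * X 0 ^ 2 - 2 * X 0 ^ 3 := rfl
    have h5 := five_eq_zero
    simp only [p, Polynomial.eval₂_add, Polynomial.eval₂_sub, Polynomial.eval₂_mul,
      Polynomial.eval₂_pow, Polynomial.eval₂_X, Polynomial.eval₂_C, Polynomial.eval₂_ofNat, map_mul, map_add, map_pow,
      map_ofNat, ha, hb]
    fin_cases i <;> simp only [Fin.zero_eta, Fin.mk_one] <;>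
      generalize (X 0 : Poly) = u, (X 1 : Poly) = v at * <;> grind
  have : Algebra.IsIntegral S Poly := by
    refine ⟨fun P => ?_⟩
    induction P using MvPolynomial.induction_on with
    | C r => exact isIntegral_algebraMap (x := algebraMap (ZMod 5) S r)
    | add P Q hP hQ => exact hP.add hQ
    | mul_X P i hP => exact hP.mul (hX i)
  have : Algebra.IsAlgebraic (Algebra.adjoin (ZMod 5) (Set.range ![invA, invB])) Poly :=
    Algebra.IsIntegral.isAlgebraic (R := S)
  refine (Algebra.IsAlgebraic.isTranscendenceBasis_of_le_trdeg_of_finite (ZMod 5)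
    ![invA, invB] ?_).1
  simp [MvPolynomial.trdeg_of_isDomain]

theorem invC_ne_zero : invC ≠ 0 := by
  intro h
  have := congrArg (eval ![1, 1]) h
  simp only [invC, map_mul, map_add, map_ofNat, eval_X] at this
  revert this
  decide

/-- The relation satisfied by the three invariants. -/
noncomputable def relation : MvPolynomial (Fin 3) (ZMod 5) := X 2 ^ 2 - 3 * (X 1 ^ 2 + X 0 ^ 3)

/-- Modulo the relation, every polynomial is linear in its last variable. -/
theorem exists_linear_remainder (P : MvPolynomial (Fin 3) (ZMod 5)) :
    ∃ f g : Poly, P - (rename (Fin.castSucc) f + rename (Fin.castSucc) g * X 2) ∈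
      Ideal.span {relation} := by
  simp only [Ideal.mem_span_singleton']
  induction P using MvPolynomial.induction_on with
  | C r => exact ⟨C r, 0, 0, by simp⟩
  | add P Q hP hQ =>
    obtain ⟨f, g, k, h⟩ := hP
    obtain ⟨f', g', k', h'⟩ := hQ
    exact ⟨f + f', g + g', k + k', by simp only [map_add]; linear_combination h + h'⟩
  | mul_X P i hP =>
    obtain ⟨f, g, k, h⟩ := hP
    induction i using Fin.lastCases with
    | cast i =>
      refine ⟨f * X i, g * X i, k * X i.castSucc, ?_⟩
      simp only [map_mul, rename_X]
      linear_combination X i.castSucc * h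
    | last =>
      refine ⟨g * (3 * (X 1 ^ 2 + X 0 ^ 3)), f, k * X 2 + rename Fin.castSucc g, ?_⟩
      have h2 : (Fin.last 2) = 2 := rfl
      simp only [map_mul, map_add, map_pow, map_ofNat, rename_X, Fin.castSucc_zero,
        Fin.castSucc_one, h2, relation] at h ⊢
      linear_combination X 2 * h

theorem ker_aeval_invariants :
    RingHom.ker (aeval (R := ZMod 5) ![invA, invB, invC]) = Ideal.span {relation} := by
  have := fact_prime_five
  have hrel : aeval (R := ZMod 5) ![invA, invB, invC] relation = 0 := by
    simp [relation, invC_sq, map_ofNat]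
  apply le_antisymm
  · intro P hP
    obtain ⟨f, g, hfg⟩ := exists_linear_remainder P
    have hle : Ideal.span {relation} ≤ RingHom.ker (aeval (R := ZMod 5) ![invA, invB, invC]) := by
      simpa [Ideal.span_le] using hrel
    have hcomp (q : Poly) : aeval (R := ZMod 5) ![invA, invB, invC] (rename Fin.castSucc q) =
        aeval ![invA, invB] q := by
      rw [aeval_rename]
      congr 2
      ext i : 1
      fin_cases i <;> rfl
    have hflip (q : Poly) : flip (aeval ![invA, invB] q) = aeval ![invA, invB] q := by
      rw [← AlgHom.comp_apply]
      congr 1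
      ext i : 1
      fin_cases i <;> simp [flip_invA, flip_invB]
    have h1 : aeval ![invA, invB] f + aeval ![invA, invB] g * invC = 0 := by
      have h := hle hfg
      rw [RingHom.mem_ker] at h hP
      rw [map_sub, hP, zero_sub, neg_eq_zero, map_add, map_mul, hcomp, hcomp, aeval_X] at h
      exact h
    have h2 := congrArg flip h1
    simp only [map_add, map_mul, map_zero, hflip, flip_invC] at h2
    have hf : aeval ![invA, invB] f = 0 := by
      linear_combination 3 * h1 + 3 * h2 - aeval ![invA, invB] f * five_eq_zero
    have hg : aeval ![invA, invB] g = 0 := by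
      rw [hf, zero_add] at h1
      exact (mul_eq_zero.mp h1).resolve_right invC_ne_zero
    have hinj := algebraicIndependent_iff.mp algebraicIndependent_invA_invB
    simpa [hinj f hf, hinj g hg] using hfg
  · simpa [Ideal.span_le] using hrel

/-- A non-trivial matrix of order three over `F_5` has trace `-1` and determinant `1`, and is not
triangular. -/
theorem entries_of_cube_eq_one {M : Matrix (Fin 2) (Fin 2) (ZMod 5)} (hM3 : M ^ 3 = 1)
    (hM1 : M ≠ 1) :
    M 1 1 = -1 - M 0 0 ∧ M 0 0 * M 1 1 - M 0 1 * M 1 0 = 1 ∧ M 0 1 ≠ 0 := by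
  set_option maxRecDepth 100000 in
  have key : ∀ a b c d : ZMod 5, (a * a + b * c) * a + (a * b + b * d) * c = 1 →
      (a * a + b * c) * b + (a * b + b * d) * d = 0 →
      (c * a + d * c) * a + (c * b + d * d) * c = 0 →
      (c * a + d * c) * b + (c * b + d * d) * d = 1 →
      (a = 1 ∧ b = 0 ∧ c = 0 ∧ d = 1) ∨ (d = -1 - a ∧ a * d - b * c = 1 ∧ b ≠ 0) := by decide
  have hent (i j : Fin 2) := congrFun (congrFun hM3 i) j
  simp only [pow_succ, pow_zero, one_mul, Matrix.mul_apply, Fin.sum_univ_two] at hent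
  refine (key _ _ _ _ (hent 0 0) (hent 0 1) (hent 1 0) (hent 1 1)).resolve_left ?_
  rintro ⟨h₁, h₂, h₃, h₄⟩
  apply hM1
  ext i j
  fin_cases i <;> fin_cases j <;> simp [h₁, h₂, h₃, h₄]

/-- The linear coordinates `u = x`, `v = r x + s y`. -/
noncomputable def coordEquiv (r s : ZMod 5) (hs : s ≠ 0) : Poly ≃ₐ[ZMod 5] Poly :=
  AlgEquiv.ofAlgHom (aeval ![X 0, C r * X 0 + C s * X 1])
    (aeval ![X 0, C s⁻¹ * (X 1 - C r * X 0)])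
    (by
      have h : (C s⁻¹ * C s : Poly) = 1 := by
        have := fact_prime_five
        rw [← C_mul, inv_mul_cancel₀ hs, C_1]
      ext i : 1
      fin_cases i
      · simp
      · simp [algHom_C, algebraMap_eq, ← mul_assoc, h])
    (by
      have h : (C s * C s⁻¹ : Poly) = 1 := by
        have := fact_prime_five
        rw [← C_mul, mul_inv_cancel₀ hs, C_1]
      ext i : 1
      fin_cases i
      · simp
      · simp [algHom_C, algebraMap_eq, ← mul_assoc, h])

theorem coordEquiv_X_zero (r s : ZMod 5) (hs : s ≠ 0) : coordEquiv r s hs (X 0) = X 0 := by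
  simp [coordEquiv]

theorem coordEquiv_X_one (r s : ZMod 5) (hs : s ≠ 0) :
    coordEquiv r s hs (X 1) = C r * X 0 + C s * X 1 := by
  simp [coordEquiv]

theorem linSub5_X (M : Matrix (Fin 2) (Fin 2) (ZMod 5)) (i : Fin 2) :
    linSub5 M (X i) = C (M i 0) * X 0 + C (M i 1) * X 1 := by
  simp [linSub5]

theorem linSub5_coordEquiv {M : Matrix (Fin 2) (Fin 2) (ZMod 5)} (htr : M 1 1 = -1 - M 0 0)
    (hdet : M 0 0 * M 1 1 - M 0 1 * M 1 0 = 1) (h01 : M 0 1 ≠ 0) (P : Poly) :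
    linSub5 M (coordEquiv (M 0 0) (M 0 1) h01 P) = coordEquiv (M 0 0) (M 0 1) h01 (rot P) := by
  suffices h : (linSub5 M).comp (coordEquiv (M 0 0) (M 0 1) h01).toAlgHom =
      (coordEquiv (M 0 0) (M 0 1) h01).toAlgHom.comp rot from DFunLike.congr_fun h P
  have htr' : (C (M 1 1) : Poly) = -1 - C (M 0 0) := by rw [htr]; simp
  have hdet' : (C (M 0 0) * C (M 1 1) - C (M 0 1) * C (M 1 0) : Poly) = 1 := by
    rw [← C_mul, ← C_mul, ← C_sub, hdet, C_1]
  ext i : 1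
  fin_cases i
  · change linSub5 M (coordEquiv _ _ h01 (X 0)) = coordEquiv _ _ h01 (rot (X 0))
    rw [rot_X_zero, coordEquiv_X_zero, coordEquiv_X_one, linSub5_X]
  · change linSub5 M (coordEquiv _ _ h01 (X 1)) = coordEquiv _ _ h01 (rot (X 1))
    simp only [rot_X_one, map_sub, map_neg, map_add, map_mul, coordEquiv_X_zero,
      coordEquiv_X_one, linSub5_X, algHom_C, algebraMap_eq]
    linear_combination (C (M 0 0) * X 0 + C (M 0 1) * X 1) * htr' - X 0 * hdet'

theorem isHomogeneous_coordEquiv {r s : ZMod 5} (hs : s ≠ 0) {P : Poly} {n : ℕ}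
    (hP : P.IsHomogeneous n) : (coordEquiv r s hs P).IsHomogeneous n := by
  have := hP.aeval (![X 0, C r * X 0 + C s * X 1] : Fin 2 → Poly) (n := 1) fun i => by
    have h (i : Fin 2) := isHomogeneous_X (ZMod 5) i
    fin_cases i
    · exact h 0
    · simpa using ((isHomogeneous_C (Fin 2) r).mul (h 0)).add
        ((isHomogeneous_C (Fin 2) s).mul (h 1))
  simpa [coordEquiv] using this

end CyclicThree

open CyclicThree in
/-- If `C_3` acts non-trivially and linearly on `F_5[x, x']` (the action being
given by a matrix `M` with `M³ = 1`, `M ≠ 1`), then the fixed-point subring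
`F_5[x,x']^{C_3}` is generated by elements `a, b, c` of degrees `2, 3, 3`
subject to the single relation `c² = 3(b² + a³)` (i.e. the kernel of the
presentation map `F_5[A,B,C] → F_5[x,x']`, `A ↦ a, B ↦ b, C ↦ c`, is the ideal
generated by `C² − 3(B² + A³)`). -/
theorem stmt_12 (p : ℕ) (hp : p.Prime)
    (M : Matrix (Fin 2) (Fin 2) (ZMod 5)) (hM3 : M ^ 3 = 1) (hM1 : M ≠ 1) :
    ∃ a b c : MvPolynomial (Fin 2) (ZMod 5),
      a.IsHomogeneous 2 ∧ b.IsHomogeneous 3 ∧ c.IsHomogeneous 3 ∧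
      (∀ P : MvPolynomial (Fin 2) (ZMod 5),
        linSub5 M P = P ↔ P ∈ Algebra.adjoin (ZMod 5) {a, b, c}) ∧
      c ^ 2 = 3 * (b ^ 2 + a ^ 3) ∧
      RingHom.ker (MvPolynomial.aeval (R := ZMod 5) ![a, b, c] :
          MvPolynomial (Fin 3) (ZMod 5) →ₐ[ZMod 5] MvPolynomial (Fin 2) (ZMod 5)) =
        Ideal.span {(X 2 : MvPolynomial (Fin 3) (ZMod 5)) ^ 2 -
          3 * ((X 1 : MvPolynomial (Fin 3) (ZMod 5)) ^ 2 +
               (X 0 : MvPolynomial (Fin 3) (ZMod 5)) ^ 3)} := by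
  obtain ⟨htr, hdet, h01⟩ := entries_of_cube_eq_one hM3 hM1
  set e := coordEquiv (M 0 0) (M 0 1) h01
  have hcomm (P : Poly) : linSub5 M (e P) = e (rot P) := linSub5_coordEquiv htr hdet h01 P
  refine ⟨e invA, e invB, e invC, isHomogeneous_coordEquiv h01 isHomogeneous_invA,
    isHomogeneous_coordEquiv h01 isHomogeneous_invB,
    isHomogeneous_coordEquiv h01 isHomogeneous_invC, fun P => ?_, ?_, ?_⟩
  · obtain ⟨Q, rfl⟩ := e.surjective P
    have himage : ({e invA, e invB, e invC} : Set Poly) =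
        e.toAlgHom '' {invA, invB, invC} := by
      simp [Set.image_insert_eq]
    rw [hcomm, e.injective.eq_iff, rot_eq_self_iff, himage, ← AlgHom.map_adjoin]
    exact (Subalgebra.mem_map.trans ⟨fun ⟨R, hR, hRQ⟩ => e.injective hRQ ▸ hR,
      fun h => ⟨Q, h, rfl⟩⟩).symm
  · simpa [map_ofNat] using congrArg e invC_sq
  · rw [← relation, ← ker_aeval_invariants]
    have hcomp : aeval (R := ZMod 5) ![e invA, e invB, e invC] =
        e.toAlgHom.comp (aeval ![invA, invB, invC]) := by
      ext i : 1
      fin_cases i <;> simp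
    ext P
    simp [RingHom.mem_ker, hcomp]
end
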